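/- For every f, g ∈ Homeo⁺(S¹): 2·c(f,g) = −o(0̇, f(0̇), (f∘g)(0̇)) + 1 + δ_{0̇}((f∘g)(0̇)) − δ_{0̇}(f(0̇)) − δ_{0̇}(g(0̇)), where 0̇ ∈ ℝ/ℤ is the image of 0 and δ_{0̇}(x) = 1 if x = 0̇ and δ_{0̇}(x) = 0 otherwise. -/

import Mathlib

open Filter MeasureTheory Set
open scoped Classical

noncomputable section

/-- The circle `S¹ = ℝ/ℤ`. -/
abbrev S1 : Type := AddCircle (1 : ℝ)

/-- `F : ℝ → ℝ` is an increasing homeomorphism of `ℝ` commuting with integer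
translations which is a lift of `f : S¹ → S¹`. -/
def IsCircleLift (f : S1 → S1) (F : ℝ → ℝ) : Prop :=
  StrictMono F ∧ Function.Surjective F ∧ (∀ x, F (x + 1) = F x + 1) ∧
    ∀ x : ℝ, f (x : S1) = (F x : S1)

/-- `f` is an orientation preserving homeomorphism of the circle. -/
def IsOPH (f : S1 → S1) : Prop := ∃ F, IsCircleLift f F

/-- The unique lift `f̄` of `f ∈ Homeo⁺(S¹)` with `f̄ 0 ∈ [0,1)`. -/
def posLift (f : S1 → S1) : ℝ → ℝ :=
  if h : ∃ F, IsCircleLift f F ∧ F 0 ∈ Set.Ico (0 : ℝ) 1 then h.choose else id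

/-- The Euler cocycle `c(f,g)`, defined by `f̄(ḡ(x)) = (f∘g)‾(x) + c(f,g)` where
`f̄` denotes the lift of `f` with `f̄ 0 ∈ [0,1)`. -/
def euler (f g : S1 → S1) : ℝ :=
  posLift f (posLift g 0) - posLift (fun x => f (g x)) 0

/-- A quasi-conjugacy: a self-map of the circle induced by a monotone increasing
map of `ℝ` commuting with integer translations. -/
def IsQuasiConjMap (h : S1 → S1) : Prop :=
  ∃ H : ℝ → ℝ, Monotone H ∧ (∀ x, H (x + 1) = H x + 1) ∧ ∀ x : ℝ, h (x : S1) = (H x : S1)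

/-- `ρ₀` and `ρ₁` are quasi-conjugate: there is a quasi-conjugacy `h` with
`h ∘ ρ₀ γ = ρ₁ γ ∘ h` for all `γ`. -/
def QuasiConj {Γ : Type*} (ρ₀ ρ₁ : Γ → S1 → S1) : Prop :=
  ∃ h, IsQuasiConjMap h ∧ ∀ γ, h ∘ ρ₀ γ = ρ₁ γ ∘ h

/-- `ρ` is an action of `Γ` on the circle by orientation preserving homeomorphisms,
i.e. a homomorphism `Γ → Homeo⁺(S¹)`. -/
def IsCircleAction (Γ : Type*) [Group Γ] (ρ : Γ → S1 → S1) : Prop :=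
  (∀ γ, IsOPH (ρ γ)) ∧ ρ 1 = id ∧ ∀ γ η, ρ (γ * η) = ρ γ ∘ ρ η

/-- `(x,y,z)` is a positively oriented triple of pairwise distinct points on the
circle. -/
def PosOriented (x y z : S1) : Prop :=
  ∃ a b c : ℝ, (a : S1) = x ∧ (b : S1) = y ∧ (c : S1) = z ∧ a < b ∧ b < c ∧ c < a + 1

/-- The orientation cocycle `o : (S¹)³ → {-1,0,1}`. -/
def orient (x y z : S1) : ℝ :=
  if PosOriented x y z then 1 else if PosOriented z y x then -1 else 0

theorem S1.coe_eq_coe_iff {x y : ℝ} : (x : S1) = (y : S1) ↔ ∃ n : ℤ, x = y + n := by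
  rw [← sub_eq_zero, ← AddCircle.coe_sub, AddCircle.coe_eq_zero_iff]
  simp only [zsmul_eq_mul, mul_one]
  exact exists_congr fun n => ⟨fun h => by linarith, fun h => by linarith⟩

theorem S1.coe_eq_zero_iff_of_mem_Ico {x : ℝ} (hx : x ∈ Set.Ico (0 : ℝ) 1) :
    (x : S1) = 0 ↔ x = 0 := by
  constructor
  · intro h
    obtain ⟨n, hn⟩ := S1.coe_eq_coe_iff.1 (h.trans (AddCircle.coe_zero (1 : ℝ)).symm)
    rw [zero_add] at hn
    obtain ⟨h0, h1⟩ := hx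
    rw [hn] at h0 h1
    have h0' : 0 ≤ n := by exact_mod_cast h0
    have h1' : n < 1 := by exact_mod_cast h1
    obtain rfl : n = 0 := by omega
    simpa using hn
  · rintro rfl
    exact AddCircle.coe_zero _

theorem IsCircleLift.comp {f g : S1 → S1} {F G : ℝ → ℝ} (hF : IsCircleLift f F)
    (hG : IsCircleLift g G) : IsCircleLift (fun x => f (g x)) (F ∘ G) := by
  obtain ⟨hF₁, hF₂, hF₃, hF₄⟩ := hF
  obtain ⟨hG₁, hG₂, hG₃, hG₄⟩ := hG
  exact ⟨hF₁.comp hG₁, hF₂.comp hG₂, fun x => by simp [hG₃, hF₃], fun x => by simp [hG₄, hF₄]⟩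

theorem IsOPH.comp {f g : S1 → S1} (hf : IsOPH f) (hg : IsOPH g) :
    IsOPH (fun x => f (g x)) := by
  obtain ⟨F, hF⟩ := hf
  obtain ⟨G, hG⟩ := hg
  exact ⟨F ∘ G, hF.comp hG⟩

theorem IsCircleLift.sub_int {f : S1 → S1} {F : ℝ → ℝ} (hF : IsCircleLift f F) (n : ℤ) :
    IsCircleLift f (fun x => F x - n) := by
  obtain ⟨h₁, h₂, h₃, h₄⟩ := hF
  refine ⟨fun x y hxy => sub_lt_sub_right (h₁ hxy) _, fun y => ?_, fun x => ?_, fun x => ?_⟩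
  · obtain ⟨x, hx⟩ := h₂ (y + n)
    exact ⟨x, by simp [hx]⟩
  · simp only [h₃]
    ring
  · rw [h₄, S1.coe_eq_coe_iff]
    exact ⟨n, by ring⟩

theorem IsOPH.posLift_spec {f : S1 → S1} (hf : IsOPH f) :
    IsCircleLift f (posLift f) ∧ posLift f 0 ∈ Set.Ico (0 : ℝ) 1 := by
  have h : ∃ F, IsCircleLift f F ∧ F 0 ∈ Set.Ico (0 : ℝ) 1 := by
    obtain ⟨F, hF⟩ := hf
    exact ⟨_, hF.sub_int ⌊F 0⌋, Int.fract_nonneg (F 0), Int.fract_lt_one (F 0)⟩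
  rw [posLift, dif_pos h]
  exact h.choose_spec

theorem posOriented_zero_left_iff {a d : ℝ} (ha : a ∈ Set.Ico (0 : ℝ) 1)
    (hd : d ∈ Set.Ico (0 : ℝ) 1) : PosOriented 0 (a : S1) (d : S1) ↔ 0 < a ∧ a < d := by
  obtain ⟨ha₀, ha₁⟩ := ha
  obtain ⟨hd₀, hd₁⟩ := hd
  constructor
  · rintro ⟨p, q, r, hp, hq, hr, hpq, hqr, hrp⟩
    rw [← AddCircle.coe_zero (1 : ℝ), S1.coe_eq_coe_iff] at hp
    rw [S1.coe_eq_coe_iff] at hq hr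
    obtain ⟨m, rfl⟩ := hp
    obtain ⟨n, rfl⟩ := hq
    obtain ⟨k, rfl⟩ := hr
    have h₁ : m < n + 1 := by exact_mod_cast (by linarith : (m : ℝ) < n + 1)
    have h₂ : n < m + 1 := by exact_mod_cast (by linarith : (n : ℝ) < m + 1)
    have h₃ : m < k + 1 := by exact_mod_cast (by linarith : (m : ℝ) < k + 1)
    have h₄ : k < m + 1 := by exact_mod_cast (by linarith : (k : ℝ) < m + 1)
    obtain rfl : n = m := by omega
    obtain rfl : k = n := by omega
    constructor <;> linarith
  · rintro ⟨h₁, h₂⟩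
    exact ⟨0, a, d, AddCircle.coe_zero _, rfl, rfl, h₁, h₂, by linarith⟩

theorem posOriented_zero_right_iff {a d : ℝ} (ha : a ∈ Set.Ico (0 : ℝ) 1)
    (hd : d ∈ Set.Ico (0 : ℝ) 1) : PosOriented (d : S1) (a : S1) 0 ↔ 0 < d ∧ d < a := by
  obtain ⟨ha₀, ha₁⟩ := ha
  obtain ⟨hd₀, hd₁⟩ := hd
  constructor
  · rintro ⟨p, q, r, hp, hq, hr, hpq, hqr, hrp⟩
    rw [← AddCircle.coe_zero (1 : ℝ), S1.coe_eq_coe_iff] at hr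
    rw [S1.coe_eq_coe_iff] at hp hq
    obtain ⟨m, rfl⟩ := hp
    obtain ⟨n, rfl⟩ := hq
    obtain ⟨k, rfl⟩ := hr
    have h₁ : m < k := by exact_mod_cast (by linarith : (m : ℝ) < k)
    have h₂ : k < m + 2 := by exact_mod_cast (by linarith : (k : ℝ) < m + 2)
    have h₃ : n < k := by exact_mod_cast (by linarith : (n : ℝ) < k)
    have h₄ : m < n + 1 := by exact_mod_cast (by linarith : (m : ℝ) < n + 1)
    obtain rfl : k = m + 1 := by omega
    obtain rfl : n = m := by omega
    push_cast at *
    constructor <;> linarith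
  · rintro ⟨h₁, h₂⟩
    exact ⟨d, a, 1, rfl, rfl, AddCircle.coe_period 1, h₂, ha₁, by linarith⟩

theorem orient_zero_coe_coe {a d : ℝ} (ha : a ∈ Set.Ico (0 : ℝ) 1)
    (hd : d ∈ Set.Ico (0 : ℝ) 1) :
    orient 0 (a : S1) (d : S1) =
      if 0 < a ∧ a < d then 1 else if 0 < d ∧ d < a then -1 else 0 := by
  simp only [orient, posOriented_zero_left_iff ha hd, posOriented_zero_right_iff ha hd]

/-- For all `f, g ∈ Homeo⁺(S¹)`:
`2c(f,g) = −o(0̇, f(0̇), fg(0̇)) + 1 + δ_{0̇}(fg(0̇)) − δ_{0̇}(f(0̇)) − δ_{0̇}(g(0̇))`. -/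
theorem two_mul_euler_eq_orientation_formula
    (f g : S1 → S1) (hf : IsOPH f) (hg : IsOPH g) :
    2 * euler f g =
      -(orient (0 : S1) (f 0) (f (g 0))) + 1 +
        ((if f (g 0) = (0 : S1) then (1 : ℝ) else 0) -
          (if f 0 = (0 : S1) then (1 : ℝ) else 0) -
          (if g 0 = (0 : S1) then (1 : ℝ) else 0)) := by
  obtain ⟨⟨hF, -, hF₁, hFf⟩, ha⟩ := hf.posLift_spec
  obtain ⟨⟨-, -, -, hGg⟩, hb⟩ := hg.posLift_spec
  obtain ⟨⟨-, -, -, hHh⟩, hd⟩ := (hf.comp hg).posLift_spec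
  rw [euler]
  have hz : ((0 : ℝ) : S1) = 0 := AddCircle.coe_zero _
  have hf0 := hFf 0
  have hg0 := hGg 0
  have hfg0 : f (g (0 : ℝ)) = _ := hHh 0
  rw [hz] at hf0 hg0 hfg0
  have hfb := hFf (posLift g 0)
  rw [← hg0, hfg0, S1.coe_eq_coe_iff] at hfb
  rw [hfg0, hf0, hg0, orient_zero_coe_coe ha hd]
  simp only [S1.coe_eq_zero_iff_of_mem_Ico ha, S1.coe_eq_zero_iff_of_mem_Ico hb,
    S1.coe_eq_zero_iff_of_mem_Ico hd]
  have hF01 := hF₁ 0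
  rw [zero_add] at hF01
  have hlt : posLift f (posLift g 0) < posLift f 0 + 1 := hF01 ▸ hF hb.2
  have hle : posLift f 0 ≤ posLift f (posLift g 0) := hF.monotone hb.1
  have heq : posLift g 0 = 0 ↔ posLift f (posLift g 0) = posLift f 0 := hF.injective.eq_iff.symm
  simp only [heq]
  generalize posLift f (posLift g 0) = e at *
  generalize posLift f 0 = a at *
  generalize posLift (fun x => f (g x)) 0 = d at *
  obtain ⟨ha₀, ha₁⟩ := ha
  obtain ⟨hd₀, hd₁⟩ := hd
  obtain ⟨n, hn⟩ := hfb
  have hn₁ : -2 < n := by exact_mod_cast (by push_cast; linarith : ((-2 : ℤ) : ℝ) < n)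
  have hn₂ : n < 2 := by exact_mod_cast (by linarith : (n : ℝ) < 2)
  interval_cases n <;> grind

end
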